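/- Let M ∈ M₅(ℝ) satisfy B(Mu, Mv) = B(u,v) for all u, v ∈ ℝ⁵ and (M z̄)₀ > 0 for every z ∈ S³, and let T_M : S³ → S³ be the induced Möbius transformation. Then the signed area density is conformally invariant: for all C¹ curves x, y : ℝ → S³ with x(s) ≠ y(t) for all s, t, the curves T_M∘x and T_M∘y have disjoint images and A_{T_M∘x, T_M∘y}(s,t) = A_{x,y}(s,t) for all (s,t). -/

import Mathlib

open Matrix

/-- The Minkowski bilinear form on ℝ⁵. -/
noncomputable def MinkB (u v : Fin 5 → ℝ) : ℝ :=
  -(u 0 * v 0) + u 1 * v 1 + u 2 * v 2 + u 3 * v 3 + u 4 * v 4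

/-- The lightlike lift `z̄ = (1, z) ∈ ℝ⁵` of a point of `S³ ⊂ ℝ⁴`. -/
noncomputable def lift (z : Fin 4 → ℝ) : Fin 5 → ℝ := Fin.cons 1 z

/-- The Möbius transformation of `S³` induced by a time-orientation preserving
pseudo-orthogonal matrix `M`: `T_M(z) = ((M z̄)₁,…,(M z̄)₄)/(M z̄)₀`. -/
noncomputable def Moeb (M : Matrix (Fin 5) (Fin 5) ℝ) (z : Fin 4 → ℝ) : Fin 4 → ℝ :=
  fun i => M.mulVec (lift z) i.succ / M.mulVec (lift z) 0

/-- The signed area density of the product torus of the link `x ∪ y`. -/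
noncomputable def Adens (x y : ℝ → (Fin 4 → ℝ)) (s t : ℝ) : ℝ :=
  ((deriv x s ⬝ᵥ deriv y t) * (x s ⬝ᵥ y t - 1)
    - (deriv x s ⬝ᵥ y t) * (x s ⬝ᵥ deriv y t)) / (x s ⬝ᵥ y t - 1) ^ 2

theorem MinkB_cons (a b : ℝ) (u v : Fin 4 → ℝ) :
    MinkB (Fin.cons a u) (Fin.cons b v) = -(a * b) + u ⬝ᵥ v := by
  simp only [MinkB, dotProduct, Fin.sum_univ_four]
  change -(a * b) + u 0 * v 0 + u 1 * v 1 + u 2 * v 2 + u 3 * v 3 = _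
  ring

theorem MinkB_lift (z w : Fin 4 → ℝ) : MinkB (lift z) (lift w) = z ⬝ᵥ w - 1 := by
  rw [lift, lift, MinkB_cons]
  ring

theorem MinkB_linear_combination (a b c d : ℝ) (p P q Q : Fin 5 → ℝ) :
    MinkB (a • p + b • P) (c • q + d • Q) =
      a * c * MinkB p q + a * d * MinkB p Q + b * c * MinkB P q + b * d * MinkB P Q := by
  simp only [MinkB, Pi.add_apply, Pi.smul_apply, smul_eq_mul]
  ring

/-- Distinct points of the unit sphere have inner product different from `1`. -/
theorem dotProduct_sub_one_ne_zero {z w : Fin 4 → ℝ} (hz : z ⬝ᵥ z = 1) (hw : w ⬝ᵥ w = 1)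
    (h : z ≠ w) : z ⬝ᵥ w - 1 ≠ 0 := by
  intro h0
  apply h
  rw [← sub_eq_zero, ← dotProduct_self_eq_zero]
  simp only [sub_dotProduct, dotProduct_sub, dotProduct_comm w z]
  linarith

theorem lift_Moeb {M : Matrix (Fin 5) (Fin 5) ℝ} {z : Fin 4 → ℝ}
    (h : M.mulVec (lift z) 0 ≠ 0) :
    lift (Moeb M z) = (M.mulVec (lift z) 0)⁻¹ • M.mulVec (lift z) := by
  ext i
  refine Fin.cases ?_ (fun j => ?_) i
  · rw [Pi.smul_apply, smul_eq_mul, inv_mul_cancel₀ h, lift, Fin.cons_zero]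
  · simp [lift, Moeb, div_eq_inv_mul]

/-- The derivative of a curve transformed by `Moeb M`, as the spatial part of a vector of `ℝ⁵`
with vanishing time component. -/
theorem cons_zero_deriv_Moeb {M : Matrix (Fin 5) (Fin 5) ℝ} {x : ℝ → Fin 4 → ℝ} {s : ℝ}
    (hx : DifferentiableAt ℝ x s) (h : M.mulVec (lift (x s)) 0 ≠ 0) :
    (Fin.cons 0 (deriv (fun s' => Moeb M (x s')) s) : Fin 5 → ℝ) =
      (M.mulVec (lift (x s)) 0)⁻¹ • M.mulVec (Fin.cons 0 (deriv x s)) +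
        (-(M.mulVec (Fin.cons 0 (deriv x s)) 0) / M.mulVec (lift (x s)) 0 ^ 2) •
          M.mulVec (lift (x s)) := by
  have hlift : HasDerivAt (fun s' => lift (x s')) (Fin.cons 0 (deriv x s)) s := by
    rw [hasDerivAt_pi]
    refine Fin.cases ?_ (fun j => ?_)
    · simpa [lift] using hasDerivAt_const s (1 : ℝ)
    · simpa [lift] using hasDerivAt_pi.1 hx.hasDerivAt j
  have hM : HasDerivAt (fun s' => M.mulVec (lift (x s'))) (M.mulVec (Fin.cons 0 (deriv x s))) s :=
    (LinearMap.toContinuousLinearMap M.mulVecLin).hasFDerivAt.comp_hasDerivAt s hlift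
  rw [hasDerivAt_pi] at hM
  have hMoeb := hasDerivAt_pi.2 fun i : Fin 4 => (hM i.succ).fun_div (hM 0) h
  have hderiv : deriv (fun s' => Moeb M (x s')) s = _ := hMoeb.deriv
  ext i
  refine Fin.cases ?_ (fun j => ?_) i
  · simp only [Fin.cons_zero, Pi.add_apply, Pi.smul_apply, smul_eq_mul]
    field_simp
    ring
  · rw [Fin.cons_succ, hderiv]
    simp only [Pi.add_apply, Pi.smul_apply, smul_eq_mul]
    field_simp
    ring

/-- the signed area density is conformally invariant. -/
theorem signed_area_density_conformally_invariant
    (M : Matrix (Fin 5) (Fin 5) ℝ)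
    (hM : ∀ u v : Fin 5 → ℝ, MinkB (M.mulVec u) (M.mulVec v) = MinkB u v)
    (hMpos : ∀ z : Fin 4 → ℝ, z ⬝ᵥ z = 1 → 0 < M.mulVec (lift z) 0)
    (x y : ℝ → (Fin 4 → ℝ))
    (hx : ContDiff ℝ 1 x) (hy : ContDiff ℝ 1 y)
    (hxS : ∀ s, x s ⬝ᵥ x s = 1) (hyS : ∀ t, y t ⬝ᵥ y t = 1)
    (hdisj : ∀ s t, x s ≠ y t) :
    (∀ s t, Moeb M (x s) ≠ Moeb M (y t)) ∧
    (∀ s t, Adens (fun s' => Moeb M (x s')) (fun t' => Moeb M (y t')) s t = Adens x y s t) := by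
  have hX s : M.mulVec (lift (x s)) 0 ≠ 0 := (hMpos _ (hxS s)).ne'
  have hY t : M.mulVec (lift (y t)) 0 ≠ 0 := (hMpos _ (hyS t)).ne'
  have hxy s t : x s ⬝ᵥ y t - 1 ≠ 0 := dotProduct_sub_one_ne_zero (hxS s) (hyS t) (hdisj s t)
  have hMoeb (z w : Fin 4 → ℝ) (hz : M.mulVec (lift z) 0 ≠ 0) (hw : M.mulVec (lift w) 0 ≠ 0) :
      Moeb M z ⬝ᵥ Moeb M w - 1 =
        (M.mulVec (lift z) 0)⁻¹ * (M.mulVec (lift w) 0)⁻¹ * (z ⬝ᵥ w - 1) := by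
    have := MinkB_linear_combination (M.mulVec (lift z) 0)⁻¹ 0 (M.mulVec (lift w) 0)⁻¹ 0
      (M.mulVec (lift z)) 0 (M.mulVec (lift w)) 0
    rw [hM, MinkB_lift] at this
    rw [← MinkB_lift, lift_Moeb hz, lift_Moeb hw]
    simpa using this
  refine ⟨fun s t heq => ?_, fun s t => ?_⟩
  · have hself := hMoeb (x s) (x s) (hX s) (hX s)
    rw [hxS, sub_self, mul_zero] at hself
    have hcross := hMoeb (x s) (y t) (hX s) (hY t)
    rw [← heq, hself] at hcross
    exact mul_ne_zero (mul_ne_zero (inv_ne_zero (hX s)) (inv_ne_zero (hY t))) (hxy s t) hcross.symm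
  · have hdx := cons_zero_deriv_Moeb (hx.differentiable one_ne_zero s) (hX s)
    have hdy := cons_zero_deriv_Moeb (hy.differentiable one_ne_zero t) (hY t)
    have hlx : lift (Moeb M (x s)) = (0 : ℝ) • M.mulVec (Fin.cons 0 (deriv x s)) +
        (M.mulVec (lift (x s)) 0)⁻¹ • M.mulVec (lift (x s)) := by
      rw [zero_smul, zero_add, lift_Moeb (hX s)]
    have hly : lift (Moeb M (y t)) = (0 : ℝ) • M.mulVec (Fin.cons 0 (deriv y t)) +
        (M.mulVec (lift (y t)) 0)⁻¹ • M.mulVec (lift (y t)) := by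
      rw [zero_smul, zero_add, lift_Moeb (hY t)]
    have hpq : MinkB (Fin.cons 0 (deriv x s)) (Fin.cons 0 (deriv y t)) =
        deriv x s ⬝ᵥ deriv y t := by
      simp [MinkB_cons]
    have hpQ : MinkB (Fin.cons 0 (deriv x s)) (lift (y t)) = deriv x s ⬝ᵥ y t := by
      simp [lift, MinkB_cons]
    have hPq : MinkB (lift (x s)) (Fin.cons 0 (deriv y t)) = x s ⬝ᵥ deriv y t := by
      simp [lift, MinkB_cons]
    have hdd := MinkB_cons 0 0 (deriv (fun s' => Moeb M (x s')) s)
      (deriv (fun t' => Moeb M (y t')) t)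
    have hdl := MinkB_cons 0 1 (deriv (fun s' => Moeb M (x s')) s) (Moeb M (y t))
    have hld := MinkB_cons 1 0 (Moeb M (x s)) (deriv (fun t' => Moeb M (y t')) t)
    rw [← lift] at hdl hld
    rw [hdx, hdy, MinkB_linear_combination, hM, hM, hM, hM, hpq, hpQ, hPq, MinkB_lift,
      mul_zero, neg_zero, zero_add] at hdd
    rw [hdx, hly, MinkB_linear_combination, hM, hM, hM, hM, hpq, hpQ, hPq, MinkB_lift,
      zero_mul, neg_zero, zero_add] at hdl
    rw [hlx, hdy, MinkB_linear_combination, hM, hM, hM, hM, hpq, hpQ, hPq, MinkB_lift,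
      mul_zero, neg_zero, zero_add] at hld
    simp only [Adens]
    rw [← hdd, ← hdl, ← hld, hMoeb (x s) (y t) (hX s) (hY t)]
    have hXs := hX s
    have hYt := hY t
    have hxyst := hxy s t
    generalize M.mulVec (lift (x s)) 0 = a at *
    generalize M.mulVec (lift (y t)) 0 = b at *
    generalize x s ⬝ᵥ y t - 1 = c at *
    field_simp
    ring
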